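/- Let F be a number field and n = 1 the unit ideal. Then the number of cusps #cusps(O_F) = ⊔_λ Γ_{1,λ}(1)\P¹(F) equals h^+ · h, where h^+ is the narrow class number and h is the class number of F. -/

import Mathlib

open NumberField FractionalIdeal
open scoped nonZeroDivisors

noncomputable section

variable (F : Type*) [Field F] [NumberField F]

/-- Total positivity of an element of `F`. -/
def TotPos (x : F) : Prop := ∀ φ : F →+* ℝ, 0 < φ x

/-- The group of invertible fractional ideals of `F`. -/
abbrev Idl := (FractionalIdeal (𝓞 F)⁰ F)ˣ

/-- The subgroup of principal fractional ideals with totally positive generator. -/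
def PrinPos : Subgroup (Idl F) :=
  Subgroup.closure {u | ∃ x : F, TotPos F x ∧
    (u : FractionalIdeal (𝓞 F)⁰ F) = spanSingleton (𝓞 F)⁰ x}

/-- The narrow class group `Cl⁺(F)`. -/
def ClPlus := Idl F ⧸ PrinPos F

instance : Group (ClPlus F) := inferInstanceAs (Group (Idl F ⧸ PrinPos F))

/-- The different ideal of `F`, as a fractional ideal. -/
def diffIdl : FractionalIdeal (𝓞 F)⁰ F :=
  (differentIdeal ℤ (𝓞 F) : FractionalIdeal (𝓞 F)⁰ F)

/-- The congruence subgroup `Γ_{1,λ}(n)`. -/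
def Gamma (tl : FractionalIdeal (𝓞 F)⁰ F) (n : Ideal (𝓞 F)) :
    Set (Matrix (Fin 2) (Fin 2) F) :=
  {M | (∃ r : 𝓞 F, (r : F) = M 0 0) ∧ (∃ r : 𝓞 F, (r : F) = M 1 1) ∧
    M 1 0 ∈ tl * diffIdl F * (n : FractionalIdeal (𝓞 F)⁰ F) ∧
    M 0 1 ∈ (tl * diffIdl F)⁻¹ ∧
    (∃ u : (𝓞 F)ˣ, ((u : 𝓞 F) : F) = M.det) ∧
    TotPos F M.det ∧
    M 1 1 - 1 ∈ (n : FractionalIdeal (𝓞 F)⁰ F)}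

/-- Nonzero vectors, representing points of `P¹(F)` by homogeneous coordinates. -/
def Vnz : Type _ := {v : Fin 2 → F // v ≠ 0}

/-- The component of the set of cusps at `λ`: `Γ_{1,λ}(n)\P¹(F)`, realized as the
quotient of `F² \ {0}` by `Γ_{1,λ}(n)` and scalars. -/
def CuspComp (tl : FractionalIdeal (𝓞 F)⁰ F) (n : Ideal (𝓞 F)) : Type _ :=
  Quot (fun v w : Vnz F => ∃ γ ∈ Gamma F tl n, ∃ s : Fˣ,
    Matrix.mulVec γ v.1 = (s : F) • w.1)

/-- The set of cusps `cusps(n) = ⊔_{λ ∈ Cl⁺(F)} Γ_{1,λ}(n)\P¹(F)`, for a choice `t`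
of representative fractional ideals. -/
def Cusps (t : ClPlus F → Idl F) (n : Ideal (𝓞 F)) : Type _ :=
  Σ l : ClPlus F, CuspComp F ((t l : Idl F) : FractionalIdeal (𝓞 F)⁰ F) n

/-- The ideal `x A + y O` attached to a vector `(x, y)`. -/
def vecIdl (A : FractionalIdeal (𝓞 F)⁰ F) (v : Fin 2 → F) : FractionalIdeal (𝓞 F)⁰ F :=
  spanSingleton (𝓞 F)⁰ (v 0) * A + spanSingleton (𝓞 F)⁰ (v 1)

variable {F}

theorem vecIdl_le {A I : FractionalIdeal (𝓞 F)⁰ F} {v : Fin 2 → F}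
    (h0 : ∀ a ∈ A, v 0 * a ∈ I) (h1 : v 1 ∈ I) : vecIdl F A v ≤ I := by
  intro z hz
  obtain ⟨i, hi, j, hj, rfl⟩ := (mem_add _ _ _).1 hz
  obtain ⟨a, ha, rfl⟩ := (mem_singleton_mul).1 hi
  have hj' := (spanSingleton_le_iff_mem.2 h1) hj
  exact Submodule.add_mem (I : Submodule (𝓞 F) F) (h0 a ha) hj'

theorem mul_mem_vecIdl {A : FractionalIdeal (𝓞 F)⁰ F} {v : Fin 2 → F} {a : F} (ha : a ∈ A) :
    v 0 * a ∈ vecIdl F A v :=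
  (mem_add _ _ _).2 ⟨_, mem_singleton_mul.2 ⟨a, ha, rfl⟩, 0, zero_mem _, add_zero _⟩

theorem one_mem_vecIdl {A : FractionalIdeal (𝓞 F)⁰ F} {v : Fin 2 → F} :
    v 1 ∈ vecIdl F A v :=
  (mem_add _ _ _).2 ⟨0, zero_mem _, _, mem_spanSingleton_self _ _, zero_add _⟩

theorem vecIdl_ne_zero {A : FractionalIdeal (𝓞 F)⁰ F} (hA : A ≠ 0) {v : Fin 2 → F}
    (hv : v ≠ 0) : vecIdl F A v ≠ 0 := by
  intro h
  apply hv
  have h1 : v 1 = 0 := by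
    have := one_mem_vecIdl (A := A) (v := v)
    rwa [h, mem_zero_iff] at this
  have h0 : v 0 = 0 := by
    obtain ⟨a, ha, hane⟩ : ∃ a ∈ A, a ≠ 0 := by
      by_contra! hh
      exact hA (eq_zero_iff.2 hh)
    have := mul_mem_vecIdl (A := A) (v := v) ha
    rw [h, mem_zero_iff] at this
    exact (mul_eq_zero.1 this).resolve_right hane
  ext i
  fin_cases i
  · exact h0
  · exact h1

theorem vecIdl_smul (A : FractionalIdeal (𝓞 F)⁰ F) (v : Fin 2 → F) (s : F) :
    vecIdl F A (s • v) = spanSingleton (𝓞 F)⁰ s * vecIdl F A v := by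
  simp only [vecIdl, Pi.smul_apply, smul_eq_mul, ← spanSingleton_mul_spanSingleton]
  ring

theorem vecIdl_mulVec_le {A : FractionalIdeal (𝓞 F)⁰ F} (hA : A ≠ 0)
    {M : Matrix (Fin 2) (Fin 2) F}
    (h00 : M 0 0 ∈ (1 : FractionalIdeal (𝓞 F)⁰ F)) (h11 : M 1 1 ∈ (1 : FractionalIdeal (𝓞 F)⁰ F))
    (h10 : M 1 0 ∈ A) (h01 : M 0 1 ∈ A⁻¹) (v : Fin 2 → F) :
    vecIdl F A (M.mulVec v) ≤ vecIdl F A v := by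
  have key : ∀ r ∈ (1 : FractionalIdeal (𝓞 F)⁰ F), ∀ x ∈ vecIdl F A v,
      r * x ∈ vecIdl F A v := by
    intro r hr x hx
    have := mul_mem_mul hr hx
    rwa [one_mul] at this
  apply vecIdl_le
  · intro a ha
    have e : M.mulVec v 0 * a = M 0 0 * (v 0 * a) + (M 0 1 * a) * v 1 := by
      simp [Matrix.mulVec, dotProduct, Fin.sum_univ_two]; ring
    rw [e]
    refine Submodule.add_mem (vecIdl F A v : Submodule (𝓞 F) F)
      (key _ h00 _ (mul_mem_vecIdl ha)) (key _ ?_ _ one_mem_vecIdl)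
    have := mul_mem_mul h01 ha
    rwa [inv_mul_cancel₀ hA] at this
  · have e : M.mulVec v 1 = v 0 * M 1 0 + M 1 1 * v 1 := by
      simp [Matrix.mulVec, dotProduct, Fin.sum_univ_two]; ring
    rw [e]
    exact Submodule.add_mem (vecIdl F A v : Submodule (𝓞 F) F)
      (mul_mem_vecIdl h10) (key _ h11 _ one_mem_vecIdl)

theorem spanSingleton_unit (u : (𝓞 F)ˣ) :
    spanSingleton (𝓞 F)⁰ ((u : 𝓞 F) : F) = 1 := by
  have h := coeIdeal_span_singleton (S := (𝓞 F)⁰) (P := F) (u : 𝓞 F)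
  rw [Ideal.span_singleton_eq_top.2 u.isUnit, coeIdeal_top] at h
  exact h.symm

theorem vecIdl_mulVec {A : FractionalIdeal (𝓞 F)⁰ F} (hA : A ≠ 0)
    {M : Matrix (Fin 2) (Fin 2) F}
    (h00 : M 0 0 ∈ (1 : FractionalIdeal (𝓞 F)⁰ F)) (h11 : M 1 1 ∈ (1 : FractionalIdeal (𝓞 F)⁰ F))
    (h10 : M 1 0 ∈ A) (h01 : M 0 1 ∈ A⁻¹) (hd : ∃ u : (𝓞 F)ˣ, ((u : 𝓞 F) : F) = M.det)
    (v : Fin 2 → F) :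
    vecIdl F A (M.mulVec v) = vecIdl F A v := by
  apply le_antisymm (vecIdl_mulVec_le hA h00 h11 h10 h01 v)
  obtain ⟨u, hu⟩ := hd
  have e : M.adjugate.mulVec (M.mulVec v) = M.det • v := by
    rw [Matrix.mulVec_mulVec, Matrix.adjugate_mul, Matrix.smul_mulVec, Matrix.one_mulVec]
  have h2 : vecIdl F A (M.det • v) = vecIdl F A v := by
    rw [vecIdl_smul, ← hu, spanSingleton_unit, one_mul]
  rw [← h2, ← e]
  apply vecIdl_mulVec_le hA
  · simpa [Matrix.adjugate_fin_two] using h11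
  · simpa [Matrix.adjugate_fin_two] using h00
  · have := Submodule.neg_mem (A : Submodule (𝓞 F) F) h10
    rw [Matrix.adjugate_fin_two]
    exact this
  · have := Submodule.neg_mem ((A⁻¹ : FractionalIdeal (𝓞 F)⁰ F) : Submodule (𝓞 F) F) h01
    rw [Matrix.adjugate_fin_two]
    exact this

/-- Completion of a vector to a matrix of determinant one. -/
theorem exists_compl {A : FractionalIdeal (𝓞 F)⁰ F} (hA : A ≠ 0) {v : Fin 2 → F} (hv : v ≠ 0) :
    ∃ p q : F, p ∈ (vecIdl F A v)⁻¹ ∧ q ∈ A * (vecIdl F A v)⁻¹ ∧ v 0 * q - v 1 * p = 1 := by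
  have h1 : (1 : F) ∈ vecIdl F A v * (vecIdl F A v)⁻¹ := by
    rw [mul_inv_cancel₀ (vecIdl_ne_zero hA hv)]
    exact one_mem_one _
  generalize hJ : (vecIdl F A v)⁻¹ = J at *
  rw [vecIdl, add_mul, mul_assoc] at h1
  obtain ⟨i, hi, j, hj, hij⟩ := (mem_add _ _ _).1 h1
  obtain ⟨q, hq, rfl⟩ := mem_singleton_mul.1 hi
  obtain ⟨p, hp, rfl⟩ := mem_singleton_mul.1 hj
  refine ⟨-p, q, Submodule.neg_mem (J : Submodule (𝓞 F) F) hp, hq, ?_⟩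
  rw [← hij]; ring

theorem exists_mat {A : FractionalIdeal (𝓞 F)⁰ F} (hA : A ≠ 0) {v w : Fin 2 → F}
    (hv : v ≠ 0) (hw : w ≠ 0) (h : vecIdl F A v = vecIdl F A w) :
    ∃ M : Matrix (Fin 2) (Fin 2) F, M 0 0 ∈ (1 : FractionalIdeal (𝓞 F)⁰ F) ∧
      M 1 1 ∈ (1 : FractionalIdeal (𝓞 F)⁰ F) ∧ M 1 0 ∈ A ∧ M 0 1 ∈ A⁻¹ ∧ M.det = 1 ∧
      M.mulVec v = w := by
  obtain ⟨p, q, hp, hq, hpq⟩ := exists_compl hA hv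
  obtain ⟨p', q', hp', hq', hpq'⟩ := exists_compl hA hw
  have hI := vecIdl_ne_zero hA hw
  have hx := fun a (ha : a ∈ A) => mul_mem_vecIdl (A := A) (v := v) ha
  have hy := one_mem_vecIdl (A := A) (v := v)
  have hx' := fun a (ha : a ∈ A) => mul_mem_vecIdl (A := A) (v := w) ha
  have hy' := one_mem_vecIdl (A := A) (v := w)
  rw [h] at hp hq hx hy
  generalize vecIdl F A w = I at *
  have toInv : ∀ x : F, (∀ a ∈ A, x * a ∈ I) → x ∈ I * A⁻¹ := by
    intro x hx
    have : spanSingleton (𝓞 F)⁰ x * A ≤ I := by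
      intro z hz
      obtain ⟨a, ha, rfl⟩ := mem_singleton_mul.1 hz
      exact hx a ha
    have h2 : spanSingleton (𝓞 F)⁰ x ≤ I * A⁻¹ := by
      calc _ = spanSingleton (𝓞 F)⁰ x * A * A⁻¹ := by rw [mul_assoc, mul_inv_cancel₀ hA, mul_one]
        _ ≤ _ := mul_le_mul_left this _
    exact spanSingleton_le_iff_mem.1 h2
  have mx := toInv _ hx
  have mx' := toInv _ hx'
  have m : ∀ {J K L : FractionalIdeal (𝓞 F)⁰ F} {x y : F}, x ∈ J → y ∈ K → J * K = L →
      x * y ∈ L := fun hx hy e => e ▸ mul_mem_mul hx hy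
  have sub : ∀ {J : FractionalIdeal (𝓞 F)⁰ F} {x y : F}, x ∈ J → y ∈ J → x - y ∈ J :=
    fun {J} _ _ hx hy => Submodule.sub_mem (J : Submodule (𝓞 F) F) hx hy
  refine ⟨!![w 0 * q - v 1 * p', v 0 * p' - w 0 * p; w 1 * q - v 1 * q', v 0 * q' - w 1 * p],
    ?_, ?_, ?_, ?_, ?_, ?_⟩
  · exact sub (m mx' hq (by field_simp)) (m hy hp' (by field_simp))
  · exact sub (m mx hq' (by field_simp)) (m hy' hp (by field_simp))
  · exact sub (m hy' hq (by field_simp)) (m hy hq' (by field_simp))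
  · exact sub (m mx hp' (by field_simp)) (m mx' hp (by field_simp))
  · rw [Matrix.det_fin_two_of]
    linear_combination (w 0 * q' - w 1 * p') * hpq + hpq'
  · ext i
    fin_cases i
    · simp [Matrix.mulVec, dotProduct, Fin.sum_univ_two]
      linear_combination w 0 * hpq
    · simp [Matrix.mulVec, dotProduct, Fin.sum_univ_two]
      linear_combination w 1 * hpq

theorem mk_eq_mk_iff (I J : Idl F) :
    ClassGroup.mk F I = ClassGroup.mk F J ↔
      ∃ s : Fˣ, spanSingleton (𝓞 F)⁰ (s : F) * (I : FractionalIdeal (𝓞 F)⁰ F) = J := by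
  rw [← (ClassGroup.equiv F).injective.eq_iff, ClassGroup.equiv_mk, ClassGroup.equiv_mk,
    QuotientGroup.mk'_eq_mk']
  constructor
  · rintro ⟨_, ⟨s, rfl⟩, h⟩
    refine ⟨s, ?_⟩
    have := congrArg Units.val h
    simpa [mul_comm] using this
  · rintro ⟨s, h⟩
    refine ⟨_, ⟨s, rfl⟩, ?_⟩
    ext1
    simpa [mul_comm] using h

theorem exists_vec {A : FractionalIdeal (𝓞 F)⁰ F} (hA : A ≠ 0) (c : ClassGroup (𝓞 F)) :
    ∃ (v : Fin 2 → F) (hv : v ≠ 0),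
      ClassGroup.mk F (Units.mk0 _ (vecIdl_ne_zero hA hv)) = c := by
  obtain ⟨J, rfl⟩ := ClassGroup.mk0_surjective c
  have hJ0 : (J : Ideal (𝓞 F)) ≠ 0 := mem_nonZeroDivisors_iff_ne_zero.1 J.2
  obtain ⟨d, B, hd, hB⟩ := exists_eq_spanSingleton_mul A
  obtain ⟨j, hj, hj0⟩ := Submodule.exists_mem_ne_zero_of_ne_bot hJ0
  have hdF : algebraMap (𝓞 F) F d ≠ 0 := by simpa using hd
  have hB0 : B ≠ 0 := by
    rintro rfl
    apply hA
    rw [hB]; simp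
  have hle : Ideal.span {j} * B ≤ (J : Ideal (𝓞 F)) :=
    Ideal.mul_le_left.trans ((Ideal.span_singleton_le_iff_mem _).2 hj)
  have hne : Ideal.span {j} * B ≠ 0 := by
    apply mul_ne_zero _ hB0
    simpa using hj0
  obtain ⟨y, hy⟩ := IsDedekindDomain.exists_sup_span_eq hle hne
  let v : Fin 2 → F := ![algebraMap (𝓞 F) F (d * j), algebraMap (𝓞 F) F y]
  have hv : v ≠ 0 := by
    intro h
    have := congrFun h 0
    simp [v, hd, hj0] at this
  refine ⟨v, hv, ?_⟩
  rw [← ClassGroup.mk_mk0 (K := F)]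
  congr 1
  ext1
  rw [Units.val_mk0, coe_mk0, ← hy, coeIdeal_sup, coeIdeal_mul, coeIdeal_span_singleton,
    coeIdeal_span_singleton, vecIdl]
  congr 1
  conv_lhs => rw [hB]
  rw [← mul_assoc, spanSingleton_mul_spanSingleton]
  congr 2
  simp only [v, Matrix.cons_val_zero, map_mul]
  field_simp

theorem diffIdl_ne_zero : diffIdl F ≠ 0 := by
  rw [diffIdl]
  exact coeIdeal_ne_zero.2 differentIdeal_ne_bot

theorem card_comp (a : Idl F) :
    Nonempty (CuspComp F (a : FractionalIdeal (𝓞 F)⁰ F) (1 : Ideal (𝓞 F)) ≃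
      ClassGroup (𝓞 F)) := by
  have hA : (a : FractionalIdeal (𝓞 F)⁰ F) * diffIdl F ≠ 0 :=
    mul_ne_zero a.ne_zero diffIdl_ne_zero
  have one_coe : ((1 : Ideal (𝓞 F)) : FractionalIdeal (𝓞 F)⁰ F) = 1 := by simp
  let f : Vnz F → ClassGroup (𝓞 F) := fun v =>
    ClassGroup.mk F (Units.mk0 _ (vecIdl_ne_zero hA v.2))
  have hf : ∀ v w : Vnz F, (∃ γ ∈ Gamma F (a : FractionalIdeal (𝓞 F)⁰ F) 1, ∃ s : Fˣ,
      Matrix.mulVec γ v.1 = (s : F) • w.1) → f v = f w := by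
    rintro v w ⟨γ, ⟨h00, h11, h10, h01, hd, -, -⟩, s, hs⟩
    rw [one_coe, mul_one] at h10
    symm
    refine (mk_eq_mk_iff _ _).2 ⟨s, ?_⟩
    rw [Units.val_mk0, Units.val_mk0, ← vecIdl_smul, ← hs]
    exact vecIdl_mulVec hA (mem_one_iff _ |>.2 h00) (mem_one_iff _ |>.2 h11) h10 h01 hd _
  refine ⟨Equiv.ofBijective (Quot.lift f hf) ⟨?_, ?_⟩⟩
  · rintro ⟨v⟩ ⟨w⟩ h
    obtain ⟨s, hs⟩ := (mk_eq_mk_iff _ _).1 h.symm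
    rw [Units.val_mk0, Units.val_mk0, ← vecIdl_smul] at hs
    obtain ⟨M, h00, h11, h10, h01, hd, hM⟩ := exists_mat hA v.2
      (smul_ne_zero s.ne_zero w.2) hs.symm
    apply Quot.sound
    refine ⟨M, ⟨(mem_one_iff _).1 h00, (mem_one_iff _).1 h11, ?_, h01, ⟨1, ?_⟩, ?_, ?_⟩, s, hM⟩
    · rw [one_coe, mul_one]; exact h10
    · simp [hd]
    · intro φ; simp [hd]
    · rw [one_coe]
      exact Submodule.sub_mem ((1 : FractionalIdeal (𝓞 F)⁰ F) : Submodule (𝓞 F) F) h11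
        (one_mem_one _)
  · intro c
    obtain ⟨v, hv, h⟩ := exists_vec hA c
    exact ⟨Quot.mk _ ⟨v, hv⟩, h⟩

variable (F)

/-- For level `n = (1)` the number of cusps equals `h⁺ · h`, the product of the
narrow class number and the class number of `F`. -/
theorem stmt14 (t : ClPlus F → Idl F) (ht : ∀ l, QuotientGroup.mk (t l) = l) :
    Nat.card (Cusps F t (1 : Ideal (𝓞 F))) =
      Nat.card (ClPlus F) * Nat.card (ClassGroup (𝓞 F)) := by
  have e : Cusps F t (1 : Ideal (𝓞 F)) ≃ ClPlus F × ClassGroup (𝓞 F) :=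
    (Equiv.sigmaCongrRight fun l => (card_comp (t l)).some).trans (Equiv.sigmaEquivProd _ _)
  rw [Nat.card_congr e, Nat.card_prod]

end
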